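/- Let L be a finite simplicial complex on vertex set V, k a field, Λ = k[t, t^{−1}], and take all weights m_v = 1 (the diagonal character ν), so γ_v = t − 1. Then for each i > 0 there is an isomorphism of Λ-modules H_i(C_•(T_L, Λ_γ)) ≅ Λ^{dim_k H̃_{i−1}(L,k)} ⊕ (Λ/(t−1)Λ)^{dim_k B_{i−1}(L,k)}, where B_•(L,k) denotes the space of simplicial boundaries of L with k-coefficients. -/

import Mathlib

open Finset

variable {V : Type} [Fintype V] [LinearOrder V]

/-- The set of faces of cardinality `c` of a finite family of finsets `L`
(for a simplicial complex, these index the `(c-1)`-simplices, with the empty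
simplex corresponding to `c = 0`). -/
abbrev Face (L : Finset (Finset V)) (c : ℕ) := {σ : Finset V // σ ∈ L ∧ σ.card = c}

/-- `L` is (the face set of) a finite abstract simplicial complex:  it contains the
empty face and is closed under passing to subsets. -/
def IsCx (L : Finset (Finset V)) : Prop :=
  ∅ ∈ L ∧ ∀ σ ∈ L, ∀ τ ⊆ σ, τ ∈ L

/-- Incidence coefficient between a face `τ` and a face `σ` (intended: `τ ⊆ σ` with
`|σ| = |τ| + 1`), twisted by the weights `z`:  if `σ = τ ∪ {v}` this is
`(-1)^{#{w ∈ τ : w < v}} ⬝ z v`, and `0` if `τ ⊄ σ`. -/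
def coeffD {R : Type} [CommRing R] (z : V → R) (τ σ : Finset V) : R :=
  if τ ⊆ σ then ∑ v ∈ σ \ τ, (-1 : R) ^ (τ.filter (fun w => w < v)).card * z v else 0

/-- The boundary map `∂^z : C_{c+1}(T_L, R_z) → C_c(T_L, R_z)` of the twisted cellular
chain complex of the toric complex `T_L`:  on a basis element `c_σ`,
`σ = {v_1 < ⋯ < v_{c+1}}`, it is `∂^z c_σ = ∑ (-1)^{r-1} z_{v_r} c_{σ ∖ {v_r}}`. -/
noncomputable def tB (R : Type) [CommRing R] (L : Finset (Finset V)) (z : V → R) (c : ℕ) :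
    (Face L (c+1) → R) →ₗ[R] (Face L c → R) :=
  Matrix.mulVecLin (fun (τ : Face L c) (σ : Face L (c+1)) => coeffD z τ.1 σ.1)

/-- The Aomoto differential on the exterior Stanley--Reisner ring `k⟨L⟩`:  the degree-`c`
piece of `k⟨L⟩` has basis the faces of cardinality `c`, and right multiplication by
`z = ∑ z_v v*` sends the monomial `e_τ` to `∑_{v : τ ∪ {v} ∈ L} ± z_v e_{τ ∪ {v}}`. -/
noncomputable def aD (k : Type) [Field k] (L : Finset (Finset V)) (z : V → k) (c : ℕ) :
    (Face L c → k) →ₗ[k] (Face L (c+1) → k) :=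
  Matrix.mulVecLin (fun (σ : Face L (c+1)) (τ : Face L c) => coeffD z τ.1 σ.1)

/-- The Aomoto--Betti number `β_i(k⟨L⟩, z)`, the dimension of the `i`-th cohomology
of the Aomoto complex `(k⟨L⟩, ·z)`. -/
noncomputable def aomotoBetti (k : Type) [Field k] (L : Finset (Finset V)) (z : V → k)
    (i : ℕ) : ℕ :=
  Module.finrank k (LinearMap.ker (aD k L z i)) -
    (match i with
     | 0 => 0
     | j+1 => Module.finrank k (LinearMap.range (aD k L z j)))

/-- The canonical degree-one element `z_W = ∑_{v ∈ W} v*` of `k⟨L⟩`, as a weight vector. -/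
def zW (k : Type) [Field k] (W : Finset V) : V → k := fun v => if v ∈ W then 1 else 0

/-- The Aomoto--Betti number `β_i(k⟨L⟩, W) = β_i(k⟨L⟩, z_W)`. -/
noncomputable def aomotoBettiW (k : Type) [Field k] (L : Finset (Finset V)) (W : Finset V)
    (i : ℕ) : ℕ :=
  aomotoBetti k L (zW k W) i

/-- The cycles in cardinality-degree `n` of the twisted chain complex `C_•(T_L, R_z)`
(in degree `0` every chain is a cycle). -/
noncomputable def cyc (R : Type) [CommRing R] (L : Finset (Finset V)) (z : V → R) :
    (n : ℕ) → Submodule R (Face L n → R)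
  | 0 => ⊤
  | (m+1) => LinearMap.ker (tB R L z m)

/-- `dim_k H_n(C_•(T_L, k_z))`, the dimension of the `n`-th twisted homology of the
toric complex `T_L` with coefficients in the rank-one system determined by `z`. -/
noncomputable def twHomDim (k : Type) [Field k] (L : Finset (Finset V)) (z : V → k)
    (n : ℕ) : ℕ :=
  Module.finrank k ↥(cyc k L z n) - Module.finrank k ↥(LinearMap.range (tB k L z n))

/-- `dim_k H̃_j(K; k)`, the `j`-th reduced simplicial homology of the complex `K`
(the chain complex of `K` including the empty face is exactly the twisted complex
with all weights equal to `1`; the degree-`j` reduced homology sits in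
cardinality-degree `j+1`). -/
noncomputable def reducedBetti (k : Type) [Field k] (K : Finset (Finset V)) (j : ℤ) : ℕ :=
  if j < -1 then 0 else twHomDim k K (fun _ => (1 : k)) (j+1).toNat

/-- The link `lk_{L_W}(σ) = {τ ∈ L_W ∣ τ ∪ σ ∈ L}` of a face `σ` in the induced
subcomplex `L_W`. -/
def linkIn (L : Finset (Finset V)) (W σ : Finset V) : Finset (Finset V) :=
  L.filter (fun τ => τ ⊆ W ∧ τ ∪ σ ∈ L)

/-- The `n`-th homology of the twisted chain complex `C_•(T_L, R_z)`, as an `R`-module. -/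
noncomputable abbrev twHomology (R : Type) [CommRing R] (L : Finset (Finset V)) (z : V → R)
    (n : ℕ) :=
  ↥(cyc R L z n) ⧸ (LinearMap.range (tB R L z n)).comap (cyc R L z n).subtype

section BaseChange

variable {k R ι κ μ : Type*} [Field k] [CommRing R] [Algebra k R] [Fintype ι] [DecidableEq ι]

/-- Extension of scalars along `k → R` of a linear map between coordinate spaces. -/
noncomputable def baseChangePi (R : Type*) [CommRing R] [Algebra k R]
    (f : (ι → k) →ₗ[k] (κ → k)) : (ι → R) →ₗ[R] (κ → R) :=
  Matrix.toLin' ((LinearMap.toMatrix' f).map (algebraMap k R))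

theorem baseChangePi_comp [Fintype κ] [DecidableEq κ]
    (g : (κ → k) →ₗ[k] (μ → k)) (f : (ι → k) →ₗ[k] (κ → k)) :
    baseChangePi R (g ∘ₗ f) = baseChangePi R g ∘ₗ baseChangePi R f := by
  simp [baseChangePi, LinearMap.toMatrix'_comp, Matrix.map_mul, Matrix.toLin'_mul]

theorem baseChangePi_id :
    baseChangePi R (LinearMap.id : (ι → k) →ₗ[k] (ι → k)) = LinearMap.id := by
  simp [baseChangePi]

theorem baseChangePi_zero : baseChangePi R (0 : (ι → k) →ₗ[k] (κ → k)) = 0 := by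
  simp [baseChangePi]

theorem baseChangePi_add (f g : (ι → k) →ₗ[k] (κ → k)) :
    baseChangePi R (f + g) = baseChangePi R f + baseChangePi R g := by
  simp [baseChangePi, Matrix.map_add]

end BaseChange

/-- A complex `X → Y → W` of `R`-modules split by explicit maps, with homology `H` and boundaries
`B`; scaling both differentials by a nonzero `a` changes the homology to `H × B / aB`. -/
theorem nonempty_homology_smul_equiv {R X Y W η ρ : Type*} [CommRing R] [IsDomain R]
    [AddCommGroup X] [Module R X] [AddCommGroup Y] [Module R Y] [AddCommGroup W] [Module R W]
    [Module.IsTorsionFree R W]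
    {a : R} (ha : a ≠ 0) (M : X →ₗ[R] Y) (N : Y →ₗ[R] W)
    (F₁ : (ρ → R) →ₗ[R] Y) (F₂ : (η → R) →ₗ[R] Y)
    (G₁ : Y →ₗ[R] (ρ → R)) (G₂ : Y →ₗ[R] (η → R))
    (K : W →ₗ[R] Y) (S : X →ₗ[R] (ρ → R)) (S' : (ρ → R) →ₗ[R] X)
    (hM : M = F₁ ∘ₗ S) (hS : S ∘ₗ S' = LinearMap.id)
    (hN₁ : N ∘ₗ F₁ = 0) (hN₂ : N ∘ₗ F₂ = 0)
    (h₁₁ : G₁ ∘ₗ F₁ = LinearMap.id) (h₁₂ : G₁ ∘ₗ F₂ = 0)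
    (h₂₁ : G₂ ∘ₗ F₁ = 0) (h₂₂ : G₂ ∘ₗ F₂ = LinearMap.id)
    (hK : F₁ ∘ₗ G₁ + F₂ ∘ₗ G₂ + K ∘ₗ N = LinearMap.id) :
    Nonempty ((↥(LinearMap.ker (a • N)) ⧸
        (LinearMap.range (a • M)).comap (LinearMap.ker (a • N)).subtype) ≃ₗ[R]
      ((η → R) × (ρ → R ⧸ Ideal.span {a}))) := by
  have hS x : S (S' x) = x := LinearMap.congr_fun hS x
  have hN₁ x : N (F₁ x) = 0 := LinearMap.congr_fun hN₁ x
  have hN₂ x : N (F₂ x) = 0 := LinearMap.congr_fun hN₂ x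
  have h₁₁ x : G₁ (F₁ x) = x := LinearMap.congr_fun h₁₁ x
  have h₁₂ x : G₁ (F₂ x) = 0 := LinearMap.congr_fun h₁₂ x
  have h₂₁ x : G₂ (F₁ x) = 0 := LinearMap.congr_fun h₂₁ x
  have h₂₂ x : G₂ (F₂ x) = x := LinearMap.congr_fun h₂₂ x
  have hK x : F₁ (G₁ x) + F₂ (G₂ x) + K (N x) = x := LinearMap.congr_fun hK x
  let φ : ↥(LinearMap.ker (a • N)) →ₗ[R] ((η → R) × (ρ → R ⧸ Ideal.span {a})) :=
    (LinearMap.prod G₂ (((Ideal.span {a}).mkQ.compLeft ρ) ∘ₗ G₁)) ∘ₗ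
      (LinearMap.ker (a • N)).subtype
  have hsurj : Function.Surjective φ := by
    rintro ⟨u, v⟩
    choose w hw using fun j => Submodule.mkQ_surjective _ (v j)
    refine ⟨⟨F₂ u + F₁ w, by simp [hN₁, hN₂]⟩, ?_⟩
    refine Prod.ext ?_ (funext fun j => ?_)
    · simp [φ, h₂₁, h₂₂]
    · simpa [φ, h₁₁, h₁₂] using hw j
  have hker : (LinearMap.range (a • M)).comap (LinearMap.ker (a • N)).subtype =
      LinearMap.ker φ := by
    ext ⟨x, hx⟩
    have hx : N x = 0 := (smul_eq_zero.mp (by simpa using hx)).resolve_left ha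
    have hφ : φ ⟨x, by simp [hx]⟩ = 0 ↔ G₂ x = 0 ∧ ∀ j, a ∣ G₁ x j := by
      simp [φ, Prod.ext_iff, funext_iff, Ideal.Quotient.eq_zero_iff_mem, Ideal.mem_span_singleton]
    rw [LinearMap.mem_ker, hφ]
    constructor
    · rintro ⟨w, hw⟩
      have hw : a • F₁ (S w) = x := by simpa [hM] using hw
      subst hw
      simp [h₂₁, h₁₁]
    · rintro ⟨h₂, h₁⟩
      choose y hy using h₁
      have hy : G₁ x = a • y := funext hy
      refine ⟨S' y, ?_⟩
      have := hK x
      simpa [hM, hS, h₂, hx, hy] using this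
  exact ⟨(Submodule.quotEquivOfEq _ _ hker).trans (φ.quotKerEquivOfSurjective hsurj)⟩

/-- A two-step complex of finite-dimensional spaces is split. -/
theorem exists_splitting {k X Y W : Type*} [Field k]
    [AddCommGroup X] [Module k X] [AddCommGroup Y] [Module k Y] [FiniteDimensional k Y]
    [AddCommGroup W] [Module k W] (M : X →ₗ[k] Y) (N : Y →ₗ[k] W) (hNM : N ∘ₗ M = 0)
    {r h : ℕ} (hr : Module.finrank k (LinearMap.range M) = r)
    (hh : Module.finrank k (LinearMap.ker N) - Module.finrank k (LinearMap.range M) = h) :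
    ∃ (F₁ : (Fin r → k) →ₗ[k] Y) (F₂ : (Fin h → k) →ₗ[k] Y)
      (G₁ : Y →ₗ[k] (Fin r → k)) (G₂ : Y →ₗ[k] (Fin h → k))
      (K : W →ₗ[k] Y) (S : X →ₗ[k] (Fin r → k)) (S' : (Fin r → k) →ₗ[k] X),
      M = F₁ ∘ₗ S ∧ S ∘ₗ S' = LinearMap.id ∧ N ∘ₗ F₁ = 0 ∧ N ∘ₗ F₂ = 0 ∧
      G₁ ∘ₗ F₁ = LinearMap.id ∧ G₁ ∘ₗ F₂ = 0 ∧ G₂ ∘ₗ F₁ = 0 ∧ G₂ ∘ₗ F₂ = LinearMap.id ∧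
      F₁ ∘ₗ G₁ + F₂ ∘ₗ G₂ + K ∘ₗ N = LinearMap.id := by
  have hBZ : LinearMap.range M ≤ LinearMap.ker N := LinearMap.range_le_ker_iff.mpr hNM
  obtain ⟨p, hp⟩ := Submodule.exists_isCompl (LinearMap.range M)
  let H : Submodule k Y := p ⊓ LinearMap.ker N
  have hsup : LinearMap.range M ⊔ H = LinearMap.ker N := by
    rw [← sup_inf_assoc_of_le p hBZ, hp.sup_eq_top, top_inf_eq]
  have hdisj : Disjoint (LinearMap.range M) H := hp.disjoint.mono_right inf_le_left
  have hdim : Module.finrank k H = h := by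
    have := Submodule.finrank_sup_add_finrank_inf_eq (LinearMap.range M) H
    rw [hsup, hdisj.eq_bot, finrank_bot] at this
    omega
  let e₁ : (Fin r → k) ≃ₗ[k] LinearMap.range M :=
    LinearEquiv.ofFinrankEq _ _ (by simp [hr])
  let e₂ : (Fin h → k) ≃ₗ[k] H := LinearEquiv.ofFinrankEq _ _ (by simp [hdim])
  let F₁ := (LinearMap.range M).subtype ∘ₗ e₁.toLinearMap
  let F₂ := H.subtype ∘ₗ e₂.toLinearMap
  have hF₁ : LinearMap.range F₁ = LinearMap.range M := by
    simp [F₁, LinearMap.range_comp]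
  have hF₂ : LinearMap.range F₂ = H := by
    simp [F₂, LinearMap.range_comp]
  have hinj : LinearMap.ker (F₁.coprod F₂) = ⊥ := by
    rw [LinearMap.ker_coprod_of_disjoint_range _ _ (by rwa [hF₁, hF₂])]
    simp [F₁, F₂, LinearMap.ker_comp]
  have hrange : LinearMap.range (F₁.coprod F₂) = LinearMap.ker N := by
    rw [LinearMap.range_coprod, hF₁, hF₂, hsup]
  obtain ⟨G, hG⟩ := (F₁.coprod F₂).exists_leftInverse_of_injective hinj
  have hG' x y : G (F₁ x + F₂ y) = (x, y) := by
    simpa using LinearMap.congr_fun hG (x, y)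
  have hG₁ x : G (F₁ x) = (x, 0) := by simpa using hG' x 0
  have hG₂ y : G (F₂ y) = (0, y) := by simpa using hG' 0 y
  have hFM x : F₁ (G (M x)).1 = M x := by
    obtain ⟨y, hy⟩ : M x ∈ LinearMap.range F₁ := hF₁ ▸ LinearMap.mem_range_self M x
    rw [← hy, hG₁]
  obtain ⟨K, hK⟩ : ∃ K : W →ₗ[k] Y, K ∘ₗ N = LinearMap.id - F₁.coprod F₂ ∘ₗ G := by
    obtain ⟨s, hs⟩ := N.rangeRestrict.exists_rightInverse_of_surjective N.range_rangeRestrict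
    obtain ⟨g, hg⟩ := s.exists_extend
    refine ⟨(LinearMap.id - F₁.coprod F₂ ∘ₗ G) ∘ₗ g, LinearMap.ext fun x => ?_⟩
    have hgx : N (g (N x)) = N x := by
      have h₁ : g (N x) = s (N.rangeRestrict x) := LinearMap.congr_fun hg (N.rangeRestrict x)
      have h₂ : N.rangeRestrict (s (N.rangeRestrict x)) = N.rangeRestrict x :=
        LinearMap.congr_fun hs (N.rangeRestrict x)
      rw [h₁]
      exact congrArg Subtype.val h₂
    obtain ⟨y, hy⟩ : x - g (N x) ∈ LinearMap.range (F₁.coprod F₂) := by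
      rw [hrange, LinearMap.mem_ker, map_sub, hgx, sub_self]
    have hGy : F₁.coprod F₂ (G (x - g (N x))) = x - g (N x) := by
      rw [← hy]
      exact congrArg _ (LinearMap.congr_fun hG y)
    rw [map_sub, map_sub] at hGy
    simp only [LinearMap.comp_apply, LinearMap.sub_apply, LinearMap.id_apply]
    rw [sub_eq_sub_iff_sub_eq_sub, ← neg_inj, neg_sub, neg_sub, ← hGy]
  let S := LinearMap.fst k _ _ ∘ₗ G ∘ₗ M
  have hS : LinearMap.range S = ⊤ := by
    rw [LinearMap.range_eq_top]
    intro x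
    obtain ⟨y, hy⟩ : F₁ x ∈ LinearMap.range M := hF₁ ▸ LinearMap.mem_range_self F₁ x
    exact ⟨y, by simp [S, hy, hG₁]⟩
  obtain ⟨S', hS'⟩ := S.exists_rightInverse_of_surjective hS
  refine ⟨F₁, F₂, LinearMap.fst k _ _ ∘ₗ G, LinearMap.snd k _ _ ∘ₗ G, K, S, S',
    ?_, hS', ?_, ?_, ?_, ?_, ?_, ?_, ?_⟩
  · ext x; simp [S, hFM]
  · exact LinearMap.range_le_ker_iff.mp (hF₁.trans_le hBZ)
  · exact LinearMap.range_le_ker_iff.mp (hF₂.trans_le inf_le_right)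
  · exact LinearMap.ext fun x => by simp [hG₁]
  · exact LinearMap.ext fun x => by simp [hG₂]
  · exact LinearMap.ext fun x => by simp [hG₁]
  · exact LinearMap.ext fun x => by simp [hG₂]
  · rw [hK]
    exact LinearMap.ext fun x => by simp

theorem nonempty_homology_smul_baseChangePi_equiv {k R ι κ μ : Type*} [Field k] [CommRing R]
    [IsDomain R] [Algebra k R] [Fintype ι] [DecidableEq ι] [Fintype κ] [DecidableEq κ]
    [Fintype μ] [DecidableEq μ] {a : R} (ha : a ≠ 0)
    (M : (ι → k) →ₗ[k] (κ → k)) (N : (κ → k) →ₗ[k] (μ → k)) (hNM : N ∘ₗ M = 0)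
    {r h : ℕ} (hr : Module.finrank k (LinearMap.range M) = r)
    (hh : Module.finrank k (LinearMap.ker N) - Module.finrank k (LinearMap.range M) = h) :
    Nonempty ((↥(LinearMap.ker (a • baseChangePi R N)) ⧸
        (LinearMap.range (a • baseChangePi R M)).comap
          (LinearMap.ker (a • baseChangePi R N)).subtype) ≃ₗ[R]
      ((Fin h → R) × (Fin r → R ⧸ Ideal.span {a}))) := by
  obtain ⟨F₁, F₂, G₁, G₂, K, S, S', hM, hS, hN₁, hN₂, h₁₁, h₁₂, h₂₁, h₂₂, hK⟩ :=
    exists_splitting M N hNM hr hh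
  refine nonempty_homology_smul_equiv ha _ _ (baseChangePi R F₁) (baseChangePi R F₂)
    (baseChangePi R G₁) (baseChangePi R G₂) (baseChangePi R K) (baseChangePi R S)
    (baseChangePi R S') ?_ ?_ ?_ ?_ ?_ ?_ ?_ ?_ ?_
  all_goals simp only [← baseChangePi_comp, ← baseChangePi_add, ← hM, hS, hN₁, hN₂, h₁₁, h₁₂,
    h₂₁, h₂₂, hK, baseChangePi_id, baseChangePi_zero]

section Simplicial

variable {V : Type} [LinearOrder V]

theorem coeffD_insert {R : Type} [CommRing R] (z : V → R) {τ : Finset V} {v : V} (hv : v ∉ τ) :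
    coeffD z τ (insert v τ) = (-1 : R) ^ (τ.filter (fun w => w < v)).card * z v := by
  simp [coeffD, hv]

theorem coeffD_const {k R : Type} [CommRing k] [CommRing R] [Algebra k R] (a : R)
    (τ σ : Finset V) :
    coeffD (fun _ => a) τ σ = a * algebraMap k R (coeffD (fun _ => (1 : k)) τ σ) := by
  unfold coeffD
  split_ifs <;> simp [Finset.mul_sum, mul_comm]

theorem tB_const [Fintype V] (k R : Type) [Field k] [CommRing R] [Algebra k R] (L : Finset (Finset V))
    (a : R) (c : ℕ) :
    tB R L (fun _ => a) c = a • baseChangePi R (tB k L (fun _ => (1 : k)) c) := by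
  have : LinearMap.toMatrix' (tB k L (fun _ => (1 : k)) c) =
      Matrix.of fun (τ : Face L c) (σ : Face L (c + 1)) => coeffD (fun _ => (1 : k)) τ.1 σ.1 :=
    LinearMap.toMatrix'_toLin' _
  rw [baseChangePi, this, ← map_smul]
  refine congrArg Matrix.toLin' ?_
  ext τ σ
  exact coeffD_const a τ.1 σ.1

theorem coeffD_mul_add_coeffD_mul {R : Type} [CommRing R] (z : V → R) {τ : Finset V} {u w : V}
    (hu : u ∉ τ) (hw : w ∉ τ) (huw : u < w) :
    coeffD z τ (insert u τ) * coeffD z (insert u τ) (insert u (insert w τ)) +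
      coeffD z τ (insert w τ) * coeffD z (insert w τ) (insert u (insert w τ)) = 0 := by
  have hw' : w ∉ insert u τ := by simp [hw, huw.ne']
  have hu' : u ∉ insert w τ := by simp [hu, huw.ne]
  rw [coeffD_insert z hu', coeffD_insert z hu, coeffD_insert z hw, Finset.insert_comm u w,
    coeffD_insert z hw', filter_insert, filter_insert, if_pos huw, if_neg huw.not_gt,
    card_insert_of_notMem (by simp [hu])]
  ring

theorem tB_comp_tB [Fintype V] {R : Type} [CommRing R] {L : Finset (Finset V)} (hL : IsCx L) (z : V → R)
    (c : ℕ) : tB R L z c ∘ₗ tB R L z (c + 1) = 0 := by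
  suffices h : Matrix.of (fun (τ : Face L c) (σ : Face L (c + 1)) => coeffD z τ.1 σ.1) *
      Matrix.of (fun (σ : Face L (c + 1)) (ρ : Face L (c + 1 + 1)) => coeffD z σ.1 ρ.1) = 0 by
    exact (Matrix.mulVecLin_mul _ _).symm.trans
      ((congrArg Matrix.mulVecLin h).trans Matrix.mulVecLin_zero)
  ext ⟨τ, hτ, hτc⟩ ⟨ρ, hρ, hρc⟩
  rw [Matrix.mul_apply, Matrix.zero_apply]
  by_cases hτρ : τ ⊆ ρ
  swap
  · refine Finset.sum_eq_zero fun σ _ => ?_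
    by_cases h : τ ⊆ σ.1
    · simp [coeffD, show ¬ σ.1 ⊆ ρ from fun h' => hτρ (h.trans h')]
    · simp [coeffD, h]
  obtain ⟨u, w, huw, hd⟩ : ∃ u w, u < w ∧ ρ \ τ = {u, w} := by
    obtain ⟨u, w, hne, hd⟩ := card_eq_two.mp
      (show (ρ \ τ).card = 2 by rw [card_sdiff_of_subset hτρ]; omega)
    rcases hne.lt_or_gt with h | h
    · exact ⟨u, w, h, hd⟩
    · exact ⟨w, u, h, by rw [hd, pair_comm]⟩
  have hu : u ∉ τ := (mem_sdiff.mp (hd ▸ mem_insert_self u {w} : u ∈ ρ \ τ)).2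
  have hw : w ∉ τ := (mem_sdiff.mp
    (hd ▸ mem_insert_of_mem (mem_singleton_self w) : w ∈ ρ \ τ)).2
  obtain rfl : ρ = insert u (insert w τ) := by
    rw [← sdiff_union_of_subset hτρ, hd]; ext; simp
  let A : Face L (c + 1) := ⟨insert u τ, hL.2 _ hρ _ (insert_subset_insert u (subset_insert w τ)),
    by rw [card_insert_of_notMem hu, hτc]⟩
  let B : Face L (c + 1) := ⟨insert w τ, hL.2 _ hρ _ (subset_insert u _),
    by rw [card_insert_of_notMem hw, hτc]⟩
  have hAB : A ≠ B := fun h => by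
    have h' : insert u τ = insert w τ := congrArg Subtype.val h
    have : u ∈ insert w τ := h' ▸ mem_insert_self u τ
    simp [hu, huw.ne] at this
  rw [Fintype.sum_eq_add A B hAB]
  · exact coeffD_mul_add_coeffD_mul z hu hw huw
  · rintro ⟨σ, hσ, hσc⟩ ⟨hA, hB⟩
    by_contra hne
    have h₁ : τ ⊆ σ := by
      by_contra h; exact hne (by simp [coeffD, h])
    have h₂ : σ ⊆ insert u (insert w τ) := by
      by_contra h; exact hne (by simp [coeffD, h])
    obtain ⟨x, hx⟩ := card_eq_one.mp
      (show (σ \ τ).card = 1 by rw [card_sdiff_of_subset h₁]; omega)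
    have hσx : σ = insert x τ := by
      rw [← sdiff_union_of_subset h₁, hx]; rfl
    have hxd : x ∈ σ \ τ := hx ▸ mem_singleton_self x
    have hxm := h₂ (mem_sdiff.mp hxd).1
    have hxτ := (mem_sdiff.mp hxd).2
    simp only [mem_insert, hxτ, or_false] at hxm
    rcases hxm with rfl | rfl
    · exact hA (Subtype.ext hσx)
    · exact hB (Subtype.ext hσx)

end Simplicial

open LaurentPolynomial in
/-- Bestvina--Brady covers.  For the diagonal character (all
weights `m_v = 1`, so `γ_v = t − 1`), for each `i > 0` there is an isomorphism of
`Λ = k[t,t⁻¹]`-modules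
`H_i(T_L^ν; k) ≅ Λ^{dim H̃_{i−1}(L;k)} ⊕ (Λ/(t−1)Λ)^{dim B_{i−1}(L;k)}`,
where `B_•(L;k)` are the simplicial boundaries of `L`. -/
theorem statement15 {V : Type} [Fintype V] [LinearOrder V] (k : Type) [Field k]
    (L : Finset (Finset V)) (hL : IsCx L) (hV : ∀ v : V, {v} ∈ L) :
    ∀ i : ℕ, 0 < i →
      Nonempty
        (twHomology (LaurentPolynomial k) L (fun _ => T 1 - 1) i ≃ₗ[LaurentPolynomial k]
          ((Fin (reducedBetti k L ((i : ℤ) - 1)) → LaurentPolynomial k) ×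
           (Fin (Module.finrank k ↥(LinearMap.range (tB k L (fun _ => (1 : k)) i))) →
             LaurentPolynomial k ⧸ Ideal.span {(T 1 - 1 : LaurentPolynomial k)}))) := by
  rintro (_ | m) hi
  · exact absurd hi (lt_irrefl 0)
  have hne : (T 1 - 1 : LaurentPolynomial k) ≠ 0 := by
    rw [sub_ne_zero, ← T_zero]
    intro h
    have := congrArg (fun f : LaurentPolynomial k => f.coeff 1) h
    simp only [T_apply] at this
    simp at this
  have hb : Module.finrank k (LinearMap.ker (tB k L (fun _ => (1 : k)) m)) -
      Module.finrank k (LinearMap.range (tB k L (fun _ => (1 : k)) (m + 1))) =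
      reducedBetti k L (((m + 1 : ℕ) : ℤ) - 1) := by
    have h₁ : ¬ (((m + 1 : ℕ) : ℤ) - 1 < -1) := by omega
    have h₂ : (((m + 1 : ℕ) : ℤ) - 1 + 1).toNat = m + 1 := by omega
    rw [reducedBetti, if_neg h₁, h₂]
    rfl
  have := nonempty_homology_smul_baseChangePi_equiv hne _ _
    (tB_comp_tB hL (fun _ => (1 : k)) m) rfl hb
  rw [← tB_const, ← tB_const] at this
  exact this
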